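/- Let S be a finite thick generalized quadrangle in which Ẽ(x) is nontrivial for every point x, and let r be a prime such that P_r = {y : r divides |Ẽ(y)|} is nonempty and is not the whole point set. Then there exists a point v not in P_r and a point u in P_r such that u and v are not collinear. -/

import Mathlib

open Equiv

section GQDefs

variable {P L : Type*}

/-- A generalized quadrangle of order `(s,t)`: every line has `s+1` points, every point is
on `t+1` lines, two distinct points are on at most one common line, and for every
non-incident point-line pair `(p, ℓ)` there is a unique pair `(q, M)` with `M` a line
through `p` and `q` a point incident with both `M` and `ℓ`. -/
structure IsGQ (I : P → L → Prop) (s t : ℕ) : Prop where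
  point_count : ∀ ℓ : L, Nat.card {p : P // I p ℓ} = s + 1
  line_count : ∀ p : P, Nat.card {ℓ : L // I p ℓ} = t + 1
  unique_line : ∀ ⦃p q : P⦄, p ≠ q → ∀ ⦃ℓ m : L⦄, I p ℓ → I q ℓ → I p m → I q m → ℓ = m
  quad : ∀ ⦃p : P⦄ ⦃ℓ : L⦄, ¬ I p ℓ →
    ∃! qM : P × L, I p qM.2 ∧ I qM.1 qM.2 ∧ I qM.1 ℓ

/-- Two points are collinear if some line is incident with both. -/
def Coll (I : P → L → Prop) (x y : P) : Prop := ∃ ℓ : L, I x ℓ ∧ I y ℓ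

/-- The automorphism group of an incidence structure, as a subgroup of
`Perm P × Perm L`: pairs of permutations preserving incidence. -/
def autGroup (I : P → L → Prop) : Subgroup (Perm P × Perm L) where
  carrier := {g | ∀ p ℓ, I (g.1 p) (g.2 ℓ) ↔ I p ℓ}
  one_mem' := fun _ _ => Iff.rfl
  mul_mem' := fun {a b} ha hb p ℓ => (ha (b.1 p) (b.2 ℓ)).trans (hb p ℓ)
  inv_mem' := by
    intro a ha p ℓ
    have h := ha (a⁻¹.1 p) (a⁻¹.2 ℓ)
    simpa using h.symm

/-- The full group `Ẽ(p)` of symmetries with center `p`: automorphisms fixing every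
point collinear with `p`. -/
def symmGroup (I : P → L → Prop) (p : P) : Subgroup (Perm P × Perm L) where
  carrier := {g | g ∈ autGroup I ∧ ∀ y : P, Coll I p y → g.1 y = y}
  one_mem' := ⟨(autGroup I).one_mem, fun _ _ => rfl⟩
  mul_mem' := by
    rintro a b ⟨ha, ha'⟩ ⟨hb, hb'⟩
    refine ⟨(autGroup I).mul_mem ha hb, fun y hy => ?_⟩
    have : (a * b).1 y = a.1 (b.1 y) := rfl
    rw [this, hb' y hy, ha' y hy]
  inv_mem' := by
    rintro a ⟨ha, ha'⟩
    refine ⟨(autGroup I).inv_mem ha, fun y hy => ?_⟩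
    have h : a⁻¹.1 (a.1 y) = y := by simp
    rw [ha' y hy] at h
    exact h

/-- `x^⊥`: the set of points collinear with `x` (including `x` itself). -/
def perpSet (I : P → L → Prop) (x : P) : Set P := {y | Coll I x y}

/-- The hyperbolic line `{x,y}^{⊥⊥}`: points collinear with every point of
`{x,y}^⊥ = x^⊥ ∩ y^⊥`. -/
def hypLine (I : P → L → Prop) (x y : P) : Set P :=
  {z | ∀ w ∈ perpSet I x ∩ perpSet I y, Coll I z w}

/-- The group `G` generated by all the point-symmetries of the quadrangle. -/
def bigGroup (I : P → L → Prop) : Subgroup (Perm P × Perm L) :=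
  ⨆ x : P, symmGroup I x

/-- The set `P_r` of `r`-points: points whose full group of symmetries has order
divisible by `r`. -/
def Pr (I : P → L → Prop) (r : ℕ) : Set P :=
  {y | r ∣ Nat.card (symmGroup I y)}

/-- The set `L_r` of lines incident with at least two points of `P_r`. -/
def Lr (I : P → L → Prop) (r : ℕ) : Set L :=
  {ℓ | ∃ x y : P, x ≠ y ∧ x ∈ Pr I r ∧ y ∈ Pr I r ∧ I x ℓ ∧ I y ℓ}

/-- The stabilizer `G_u` of a point `u` in a group `G` of automorphisms. -/
def stabPt (G : Subgroup (Perm P × Perm L)) (u : P) : Subgroup (Perm P × Perm L) where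
  carrier := {g | g ∈ G ∧ g.1 u = u}
  one_mem' := ⟨G.one_mem, rfl⟩
  mul_mem' := by
    rintro a b ⟨ha, ha'⟩ ⟨hb, hb'⟩
    refine ⟨G.mul_mem ha hb, ?_⟩
    have : (a * b).1 u = a.1 (b.1 u) := rfl
    rw [this, hb', ha']
  inv_mem' := by
    rintro a ⟨ha, ha'⟩
    refine ⟨G.inv_mem ha, ?_⟩
    have h : a⁻¹.1 (a.1 u) = u := by simp
    rw [ha'] at h
    exact h

/-- The setwise stabilizer `G_ℓ` of a line `ℓ` in a group `G` of automorphisms. -/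
def stabLine (G : Subgroup (Perm P × Perm L)) (ℓ : L) : Subgroup (Perm P × Perm L) where
  carrier := {g | g ∈ G ∧ g.2 ℓ = ℓ}
  one_mem' := ⟨G.one_mem, rfl⟩
  mul_mem' := by
    rintro a b ⟨ha, ha'⟩ ⟨hb, hb'⟩
    refine ⟨G.mul_mem ha hb, ?_⟩
    have : (a * b).2 ℓ = a.2 (b.2 ℓ) := rfl
    rw [this, hb', ha']
  inv_mem' := by
    rintro a ⟨ha, ha'⟩
    refine ⟨G.inv_mem ha, ?_⟩
    have h : a⁻¹.2 (a.2 ℓ) = ℓ := by simp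
    rw [ha'] at h
    exact h

/-- Isomorphism of incidence structures: a pair of bijections between the point sets and
the line sets preserving incidence in both directions. -/
def IsoTo {P L P' L' : Type*} (I : P → L → Prop) (I' : P' → L' → Prop) : Prop :=
  ∃ (e : P ≃ P') (f : L ≃ L'), ∀ p ℓ, I' (e p) (f ℓ) ↔ I p ℓ

end GQDefs

section ClassicalGQs

/-- The standard nondegenerate alternating bilinear form on `F^4`. -/
def sympForm {F : Type*} [Field F] (x y : Fin 4 → F) : F :=
  x 0 * y 1 - x 1 * y 0 + x 2 * y 3 - x 3 * y 2

/-- Points of `W(3,q)`: the `1`-dimensional subspaces of `F_q^4`. -/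
def W3Point (F : Type*) [Field F] : Type _ :=
  {W : Submodule F (Fin 4 → F) // Module.finrank F W = 1}

/-- Lines of `W(3,q)`: the `2`-dimensional totally isotropic subspaces of `F_q^4` with
respect to a nondegenerate alternating form. -/
def W3Line (F : Type*) [Field F] : Type _ :=
  {U : Submodule F (Fin 4 → F) //
    Module.finrank F U = 2 ∧ ∀ x ∈ U, ∀ y ∈ U, sympForm x y = 0}

/-- Incidence in `W(3,q)` is given by inclusion. -/
def W3Incid (F : Type*) [Field F] : W3Point F → W3Line F → Prop :=
  fun W U => W.1 ≤ U.1

/-- The standard nondegenerate Hermitian sesquilinear form on `F_{q²}^4`, relative to the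
field automorphism `x ↦ x^q`. -/
def hermForm3 {F : Type*} [Field F] (q : ℕ) (x y : Fin 4 → F) : F :=
  x 0 * y 1 ^ q + x 1 * y 0 ^ q + x 2 * y 3 ^ q + x 3 * y 2 ^ q

/-- The standard nondegenerate Hermitian sesquilinear form on `F_{q²}^5`, relative to the
field automorphism `x ↦ x^q`. -/
def hermForm4 {F : Type*} [Field F] (q : ℕ) (x y : Fin 5 → F) : F :=
  x 0 * y 1 ^ q + x 1 * y 0 ^ q + x 2 * y 3 ^ q + x 3 * y 2 ^ q + x 4 * y 4 ^ q

/-- Points of `H(3,q²)`: the `1`-dimensional isotropic subspaces of `F_{q²}^4`. -/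
def H3Point (F : Type*) [Field F] (q : ℕ) : Type _ :=
  {W : Submodule F (Fin 4 → F) //
    Module.finrank F W = 1 ∧ ∀ x ∈ W, hermForm3 q x x = 0}

/-- Lines of `H(3,q²)`: the `2`-dimensional totally isotropic subspaces of `F_{q²}^4`. -/
def H3Line (F : Type*) [Field F] (q : ℕ) : Type _ :=
  {U : Submodule F (Fin 4 → F) //
    Module.finrank F U = 2 ∧ ∀ x ∈ U, ∀ y ∈ U, hermForm3 q x y = 0}

/-- Incidence in `H(3,q²)` is given by inclusion. -/
def H3Incid (F : Type*) [Field F] (q : ℕ) : H3Point F q → H3Line F q → Prop :=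
  fun W U => W.1 ≤ U.1

/-- Points of `H(4,q²)`: the `1`-dimensional isotropic subspaces of `F_{q²}^5`. -/
def H4Point (F : Type*) [Field F] (q : ℕ) : Type _ :=
  {W : Submodule F (Fin 5 → F) //
    Module.finrank F W = 1 ∧ ∀ x ∈ W, hermForm4 q x x = 0}

/-- Lines of `H(4,q²)`: the `2`-dimensional totally isotropic subspaces of `F_{q²}^5`. -/
def H4Line (F : Type*) [Field F] (q : ℕ) : Type _ :=
  {U : Submodule F (Fin 5 → F) //
    Module.finrank F U = 2 ∧ ∀ x ∈ U, ∀ y ∈ U, hermForm4 q x y = 0}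

/-- Incidence in `H(4,q²)` is given by inclusion. -/
def H4Incid (F : Type*) [Field F] (q : ℕ) : H4Point F q → H4Line F q → Prop :=
  fun W U => W.1 ≤ U.1

end ClassicalGQs

/-- If more than two elements satisfy `p`, one of them avoids two given elements. -/
theorem exists_ne_ne_of_two_lt_card {α : Type*} [Finite α] {p : α → Prop}
    (h : 2 < Nat.card {a // p a}) (x y : α) : ∃ a, p a ∧ a ≠ x ∧ a ≠ y := by
  by_contra! H
  have hsub : {a | p a} ⊆ {x, y} := fun a ha => by
    by_cases hx : a = x
    · exact Or.inl hx
    · exact Or.inr (H a ha hx)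
  have hle : Set.ncard {a | p a} ≤ 2 :=
    (Set.ncard_le_ncard hsub (Set.toFinite _)).trans ((Set.ncard_insert_le x {y}).trans (by simp))
  exact absurd h (not_lt.mpr hle)

theorem Coll.symm {P L : Type*} {I : P → L → Prop} {x y : P} (h : Coll I x y) : Coll I y x :=
  let ⟨ℓ, hx, hy⟩ := h
  ⟨ℓ, hy, hx⟩

/-- A generalized quadrangle has no triangles. -/
theorem IsGQ.not_coll {P L : Type*} {I : P → L → Prop} {s t : ℕ} (hGQ : IsGQ I s t)
    {x w z : P} {ℓ m : L} (hxℓ : I x ℓ) (hwℓ : I w ℓ) (hwm : I w m) (hzm : I z m)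
    (hℓm : m ≠ ℓ) (hwx : w ≠ x) (hzw : z ≠ w) : ¬ Coll I x z := by
  rintro ⟨k, hxk, hzk⟩
  have hzℓ : ¬ I z ℓ := fun hzℓ => hℓm (hGQ.unique_line hzw hzm hwm hzℓ hwℓ)
  have heq : ((w, m) : P × L) = (x, k) :=
    (hGQ.quad hzℓ).unique ⟨hzm, hwm, hwℓ⟩ ⟨hzk, hxk, hxℓ⟩
  exact hwx (congrArg Prod.fst heq)

/-- In a thick generalized quadrangle, any two collinear points have a common
noncollinear point. -/
theorem IsGQ.exists_not_coll_both {P L : Type*} [Finite P] [Finite L] {I : P → L → Prop}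
    {s t : ℕ} (hGQ : IsGQ I s t) (hs : 2 ≤ s) (ht : 2 ≤ t) {x y : P} (hxy : Coll I x y) :
    ∃ z, ¬ Coll I x z ∧ ¬ Coll I y z := by
  obtain ⟨ℓ, hxℓ, hyℓ⟩ := hxy
  obtain ⟨w, hwℓ, hwx, hwy⟩ :=
    exists_ne_ne_of_two_lt_card (by rw [hGQ.point_count ℓ]; omega) x y
  obtain ⟨m, hwm, hmℓ, -⟩ :=
    exists_ne_ne_of_two_lt_card (by rw [hGQ.line_count w]; omega) ℓ ℓ
  obtain ⟨z, hzm, hzw, -⟩ :=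
    exists_ne_ne_of_two_lt_card (by rw [hGQ.point_count m]; omega) w w
  exact ⟨z, hGQ.not_coll hxℓ hwℓ hwm hzm hmℓ hwx hzw, hGQ.not_coll hyℓ hwℓ hwm hzm hmℓ hwy hzw⟩

/-- If `P_r` is nonempty and is not the whole point set, then some point outside `P_r`
is noncollinear with some point of `P_r`. -/
theorem exists_noncollinear_outside_Pr {P L : Type} [Finite P] [Finite L]
    (I : P → L → Prop) (s t : ℕ) (hGQ : IsGQ I s t) (hs : 2 ≤ s) (ht : 2 ≤ t)
    (hE : ∀ x : P, symmGroup I x ≠ ⊥)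
    (r : ℕ) (hr : r.Prime) (hne : (Pr I r).Nonempty) (hproper : Pr I r ≠ Set.univ) :
    ∃ v : P, v ∉ Pr I r ∧ ∃ u ∈ Pr I r, ¬ Coll I u v := by
  by_contra! H
  obtain ⟨u, hu⟩ := hne
  obtain ⟨v, hv⟩ := (Set.ne_univ_iff_exists_notMem _).mp hproper
  obtain ⟨z, hzu, hzv⟩ := hGQ.exists_not_coll_both hs ht (H v hv u hu)
  by_cases hz : z ∈ Pr I r
  · exact hzv (H v hv z hz).symm
  · exact hzu (H z hz u hu)
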